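/- (Almost convexity of the Augustin information in the prior.) For every α ∈ (0,1], all probability vectors P_0, P_1 on {1,…,n}, and all β ∈ (0,1): I^{(2)}_α(β·P_1 + (1−β)·P_0, W) ≤ β·I^{(2)}_α(P_1,W) + (1−β)·I^{(2)}_α(P_0,W) + h(β). -/

import Mathlib

open Matrix
open scoped ComplexOrder

/-- Real power of a (hermitian) matrix via the continuous functional calculus. -/
noncomputable def mpow {ι : Type*} [Fintype ι] [DecidableEq ι]
    (A : Matrix ι ι ℂ) (r : ℝ) : Matrix ι ι ℂ :=
  cfc (fun x : ℝ => x ^ r) A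

/-- Logarithm of a (hermitian) matrix via the continuous functional calculus. -/
noncomputable def mlog {ι : Type*} [Fintype ι] [DecidableEq ι]
    (A : Matrix ι ι ℂ) : Matrix ι ι ℂ :=
  cfc Real.log A

/-- Real part of the trace. -/
noncomputable def trR {ι : Type*} [Fintype ι] (A : Matrix ι ι ℂ) : ℝ :=
  (Matrix.trace A).re

/-- Positive definite density matrices. -/
def Dens (d : ℕ) : Type :=
  {σ : Matrix (Fin d) (Fin d) ℂ // σ.PosDef ∧ σ.trace = 1}

/-- Umegaki relative entropy. -/
noncomputable def Dumegaki {d : ℕ} (ρ σ : Matrix (Fin d) (Fin d) ℂ) : ℝ :=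
  trR (ρ * (mlog ρ - mlog σ))

/-- Petz Rényi divergence, extended to `α = 1` by the Umegaki relative entropy. -/
noncomputable def DpetzFull {d : ℕ} (α : ℝ) (ρ σ : Matrix (Fin d) (Fin d) ℂ) : ℝ :=
  if α = 1 then Dumegaki ρ σ
  else (1 / (α - 1)) * Real.log (trR (mpow ρ α * mpow σ (1 - α)))

/-- Petz Augustin information. -/
noncomputable def augustinInfo {d n : ℕ} (α : ℝ) (W : Fin n → Matrix (Fin d) (Fin d) ℂ)
    (P : Fin n → ℝ) : ℝ :=
  ⨅ σ : Dens d, ∑ i, P i * DpetzFull α (W i) σ.1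

/-- Binary entropy. -/
noncomputable def bent (δ : ℝ) : ℝ := -δ * Real.log δ - (1 - δ) * Real.log (1 - δ)

section Comparison

open scoped MatrixOrder Matrix.Norms.L2Operator

variable {ι : Type*} [Fintype ι] [DecidableEq ι]

theorem mpow_eq_rpow {A : Matrix ι ι ℂ} (hA : A.PosDef) (r : ℝ) : mpow A r = A ^ r :=
  (CFC.rpow_eq_cfc_real hA.posSemidef.nonneg).symm

theorem posDef_mpow {A : Matrix ι ι ℂ} (hA : A.PosDef) (r : ℝ) : (mpow A r).PosDef := by
  rw [mpow_eq_rpow hA]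
  exact (IsStrictlyPositive.rpow A r hA.isStrictlyPositive).posDef

theorem mpow_smul {A : Matrix ι ι ℂ} (hA : A.PosDef) {c : ℝ} (hc : 0 < c) (r : ℝ) :
    mpow (c • A) r = c ^ r • mpow A r := by
  have hpos : ∀ x ∈ spectrum ℝ A, 0 < x := fun x hx =>
    hA.isStrictlyPositive.spectrum_pos hx
  have hsa : IsSelfAdjoint A := hA.isHermitian
  rw [mpow_eq_rpow (hA.smul hc), ← cfc_const_mul_id (R := ℝ) c A,
    CFC.cfc_rpow fun x hx => mul_pos hc (hpos x hx), mpow,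
    ← cfc_smul (c ^ r) (fun x : ℝ => x ^ r) A
      (ContinuousOn.rpow_const (f := id) (by fun_prop) fun x hx => Or.inl (hpos x hx).ne')]
  exact cfc_congr fun x hx => Real.mul_rpow hc.le (hpos x hx).le

theorem mpow_le_mpow {A B : Matrix ι ι ℂ} (hA : A.PosDef) (hB : B.PosDef) (hAB : A ≤ B)
    {r : ℝ} (hr : r ∈ Set.Icc (0 : ℝ) 1) : mpow A r ≤ mpow B r := by
  rw [mpow_eq_rpow hA, mpow_eq_rpow hB]
  exact CFC.rpow_le_rpow hr hAB

theorem mlog_le_mlog {A B : Matrix ι ι ℂ} (hA : A.PosDef) (hAB : A ≤ B) : mlog A ≤ mlog B :=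
  CFC.log_le_log hAB hA.isStrictlyPositive

theorem mlog_smul {A : Matrix ι ι ℂ} (hA : A.PosDef) {c : ℝ} (hc : 0 < c) :
    mlog (c • A) = algebraMap ℝ (Matrix ι ι ℂ) (Real.log c) + mlog A :=
  CFC.log_smul' A hc hA.isStrictlyPositive

theorem trR_mul_nonneg {A B : Matrix ι ι ℂ} (hA : A.PosSemidef) (hB : B.PosSemidef) :
    0 ≤ trR (A * B) := by
  obtain ⟨X, rfl⟩ := CStarAlgebra.nonneg_iff_eq_star_mul_self.mp hA.nonneg
  rw [trR, mul_assoc, trace_mul_comm]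
  exact (Complex.le_def.mp (hB.mul_mul_conjTranspose_same X).trace_nonneg).1

theorem trR_mul_le_trR_mul {A B C : Matrix ι ι ℂ} (hA : A.PosSemidef) (hBC : B ≤ C) :
    trR (A * B) ≤ trR (A * C) := by
  have h := trR_mul_nonneg hA (le_iff.mp hBC)
  simp only [trR, mul_sub, trace_sub, Complex.sub_re] at h ⊢
  linarith

theorem trR_mul_pos [Nonempty ι] {A B : Matrix ι ι ℂ} (hA : A.PosDef) (hB : B.PosDef) :
    0 < trR (A * B) := by
  obtain ⟨X, hX, rfl⟩ :=
    CStarAlgebra.isStrictlyPositive_iff_eq_star_mul_self.mp hA.isStrictlyPositive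
  rw [trR, mul_assoc, trace_mul_comm]
  exact (Complex.lt_def.mp
    (hB.mul_mul_conjTranspose_same (vecMul_injective_of_isUnit hX)).trace_pos).1

theorem trR_mul_smul (A B : Matrix ι ι ℂ) (c : ℝ) : trR (A * c • B) = c * trR (A * B) := by
  simp [trR]

/-- A lower bound `c • τ ≤ σ` costs at most `-log c` in the Petz divergence. -/
theorem DpetzFull_le_sub_log {d : ℕ} (hd : 0 < d) {α : ℝ} (hα : α ∈ Set.Ioc (0 : ℝ) 1)
    {ρ σ τ : Matrix (Fin d) (Fin d) ℂ} (hρ : ρ.PosDef) (hρ1 : ρ.trace = 1) (hσ : σ.PosDef)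
    (hτ : τ.PosDef) {c : ℝ} (hc : 0 < c) (h : c • τ ≤ σ) :
    DpetzFull α ρ σ ≤ DpetzFull α ρ τ - Real.log c := by
  have : Nonempty (Fin d) := ⟨⟨0, hd⟩⟩
  have hcτ : (c • τ).PosDef := hτ.smul hc
  by_cases h1 : α = 1
  · simp only [DpetzFull, if_pos h1, Dumegaki]
    have hle := trR_mul_le_trR_mul hρ.posSemidef (mlog_le_mlog hcτ h)
    rw [mlog_smul hτ hc, Algebra.algebraMap_eq_smul_one] at hle
    simp only [trR, mul_sub, mul_add, mul_smul_comm, mul_one, trace_sub, trace_add, trace_smul,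
      hρ1, Complex.sub_re, Complex.add_re, Complex.real_smul, Complex.ofReal_re] at hle ⊢
    linarith
  · have hα1 : 0 < 1 - α := sub_pos.mpr (lt_of_le_of_ne hα.2 h1)
    simp only [DpetzFull, if_neg h1]
    have hle := trR_mul_le_trR_mul (posDef_mpow hρ α).posSemidef
      (mpow_le_mpow hcτ hσ h ⟨hα1.le, by linarith [hα.1]⟩)
    have hpos := trR_mul_pos (posDef_mpow hρ α) (posDef_mpow hτ (1 - α))
    have hcp := Real.rpow_pos_of_pos hc (1 - α)
    rw [mpow_smul hτ hc, trR_mul_smul] at hle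
    have hlog := Real.log_le_log (mul_pos hcp hpos) hle
    rw [Real.log_mul hcp.ne' hpos.ne', Real.log_rpow hc] at hlog
    have hmul := mul_le_mul_of_nonpos_left hlog (one_div_nonpos.mpr
      (sub_nonpos.mpr hα.2))
    have hne : α - 1 ≠ 0 := sub_ne_zero.mpr h1
    have hcancel : 1 / (α - 1) * ((1 - α) * Real.log c) = -Real.log c := by
      field_simp
      ring
    rw [mul_add, hcancel] at hmul
    linarith

theorem Dens.le_one {d : ℕ} (σ : Dens d) : σ.1 ≤ 1 := by
  have hH := σ.2.1.isHermitian
  have hsum : ∑ i, hH.eigenvalues i = 1 := by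
    have h := hH.trace_eq_sum_eigenvalues.symm.trans σ.2.2
    simpa using congrArg Complex.re h
  refine CFC.le_one (p := IsSelfAdjoint) (R := ℝ) (fun x hx => ?_) hH
  obtain ⟨i, rfl⟩ := hH.spectrum_real_eq_range_eigenvalues ▸ hx
  rw [← hsum]
  exact Finset.single_le_sum (fun j _ => σ.2.1.posSemidef.eigenvalues_nonneg j)
    (Finset.mem_univ i)

theorem bddBelow_range_sum_DpetzFull {d n : ℕ} (hd : 0 < d)
    {W : Fin n → Matrix (Fin d) (Fin d) ℂ} (hW : ∀ i, (W i).PosDef ∧ (W i).trace = 1)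
    {α : ℝ} (hα : α ∈ Set.Ioc (0 : ℝ) 1) {P : Fin n → ℝ} (hP : ∀ i, 0 ≤ P i) :
    BddBelow (Set.range fun σ : Dens d => ∑ i, P i * DpetzFull α (W i) σ.1) := by
  refine ⟨∑ i, P i * DpetzFull α (W i) 1, ?_⟩
  rintro _ ⟨σ, rfl⟩
  refine Finset.sum_le_sum fun i _ => mul_le_mul_of_nonneg_left ?_ (hP i)
  simpa using DpetzFull_le_sub_log hd hα (hW i).1 (hW i).2 .one σ.2.1 one_pos
    (by simpa using σ.le_one)

theorem Dens.exists_mix {d : ℕ} (σ₀ σ₁ : Dens d) {β : ℝ} (hβ : β ∈ Set.Ioo (0 : ℝ) 1) :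
    ∃ σ : Dens d, β • σ₁.1 ≤ σ.1 ∧ (1 - β) • σ₀.1 ≤ σ.1 := by
  have h₁ : (β • σ₁.1).PosDef := σ₁.2.1.smul hβ.1
  have h₀ : ((1 - β) • σ₀.1).PosDef := σ₀.2.1.smul (sub_pos.mpr hβ.2)
  refine ⟨⟨β • σ₁.1 + (1 - β) • σ₀.1, h₁.add h₀, ?_⟩, ?_, ?_⟩
  · rw [trace_add, trace_smul, trace_smul, σ₁.2.2, σ₀.2.2, ← add_smul]
    simp
  · exact le_add_of_nonneg_right h₀.posSemidef.nonneg
  · exact le_add_of_nonneg_left h₁.posSemidef.nonneg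

theorem nonempty_dens {d : ℕ} (hd : 0 < d) : Nonempty (Dens d) := by
  have hd' : (0 : ℝ) < d := by exact_mod_cast hd
  refine ⟨⟨(d : ℝ)⁻¹ • 1, PosDef.one.smul (inv_pos.mpr hd'), ?_⟩⟩
  simp [trace_smul, hd.ne']

end Comparison

/-- almost convexity of the Augustin information in the prior. -/
theorem augustinInfo_almost_convex_in_prior {d n : ℕ} (hd : 0 < d) (hn : 0 < n)
    (W : Fin n → Matrix (Fin d) (Fin d) ℂ)
    (hW : ∀ i, (W i).PosDef ∧ (W i).trace = 1)
    (α : ℝ) (hα : α ∈ Set.Ioc (0 : ℝ) 1) :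
    ∀ P₀ P₁ : Fin n → ℝ,
      (∀ i, 0 ≤ P₀ i) → ∑ i, P₀ i = 1 →
      (∀ i, 0 ≤ P₁ i) → ∑ i, P₁ i = 1 →
      ∀ β : ℝ, β ∈ Set.Ioo (0 : ℝ) 1 →
        augustinInfo α W (fun i => β * P₁ i + (1 - β) * P₀ i) ≤
          β * augustinInfo α W P₁ + (1 - β) * augustinInfo α W P₀ + bent β := by
  intro P₀ P₁ hP₀ hP₀1 hP₁ hP₁1 β hβ
  have hβ' : 0 < 1 - β := sub_pos.mpr hβ.2
  have := nonempty_dens hd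
  have hmix : ∀ σ₀ σ₁ : Dens d,
      augustinInfo α W (fun i => β * P₁ i + (1 - β) * P₀ i) ≤
        β * ∑ i, P₁ i * DpetzFull α (W i) σ₁.1 +
          (1 - β) * ∑ i, P₀ i * DpetzFull α (W i) σ₀.1 + bent β := by
    intro σ₀ σ₁
    obtain ⟨σ, hσ₁, hσ₀⟩ := Dens.exists_mix σ₀ σ₁ hβ
    have hle : ∀ P : Fin n → ℝ, (∀ i, 0 ≤ P i) → ∑ i, P i = 1 → ∀ (c : ℝ) (τ : Dens d),
        0 < c → (σ.1 - c • τ.1).PosSemidef →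
        ∑ i, P i * DpetzFull α (W i) σ.1 ≤
          ∑ i, P i * DpetzFull α (W i) τ.1 - Real.log c := by
      intro P hP hP1 c τ hc hτ
      calc _ ≤ ∑ i, P i * (DpetzFull α (W i) τ.1 - Real.log c) :=
            Finset.sum_le_sum fun i _ => mul_le_mul_of_nonneg_left
              (DpetzFull_le_sub_log hd hα (hW i).1 (hW i).2 σ.2.1 τ.2.1 hc hτ) (hP i)
        _ = _ := by
            simp only [mul_sub, Finset.sum_sub_distrib, ← Finset.sum_mul, hP1, one_mul]
    have h₁ := mul_le_mul_of_nonneg_left (hle P₁ hP₁ hP₁1 β σ₁ hβ.1 hσ₁) hβ.1.le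
    have h₀ := mul_le_mul_of_nonneg_left (hle P₀ hP₀ hP₀1 (1 - β) σ₀ hβ' hσ₀) hβ'.le
    have hinf := ciInf_le (bddBelow_range_sum_DpetzFull hd hW hα
      (P := fun i => β * P₁ i + (1 - β) * P₀ i) fun i =>
        add_nonneg (mul_nonneg hβ.1.le (hP₁ i)) (mul_nonneg hβ'.le (hP₀ i))) σ
    refine hinf.trans ?_
    simp only [add_mul, Finset.sum_add_distrib, mul_assoc, ← Finset.mul_sum, bent]
    linarith
  rw [augustinInfo.eq_1 α W P₁, augustinInfo.eq_1 α W P₀, Real.mul_iInf_of_nonneg hβ.1.le,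
    Real.mul_iInf_of_nonneg hβ'.le, ← sub_le_iff_le_add]
  refine le_ciInf_add_ciInf fun σ₁ σ₀ => ?_
  linarith [hmix σ₀ σ₁]
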